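/- No polynomial solutions: let λ ∈ ℂ with Re λ ≥ 0 and suppose g : ℂ → ℂ is a polynomial that satisfies, for all z ∈ ℂ \ {0, 1, 2}, the Heun equation g''(z) + (7/(2z) + λ/(z−1) + 1/(2(z−2))) g'(z) + (1/4)((λ+4)(λ+2)z − (λ²+12λ+12))/(z(z−1)(z−2)) g(z) = 0. Then g = 0. -/

import Mathlib

/-- The Heun equation for functions of a complex variable. -/
def HeunEqC (l : ℂ) (g : ℂ → ℂ) (z : ℂ) : Prop :=
  deriv (deriv g) z
    + (7 / (2 * z) + l / (z - 1) + 1 / (2 * (z - 2))) * deriv g z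
    + (1 / 4) * (((l + 4) * (l + 2) * z - (l ^ 2 + 12 * l + 12)) /
        (z * (z - 1) * (z - 2))) * g z = 0

open Polynomial in
/-- Clearing denominators turns the Heun equation for a polynomial into a polynomial identity. -/
theorem heun_polynomial_identity (l : ℂ) (P : Polynomial ℂ)
    (heq : ∀ z : ℂ, z ≠ 0 → z ≠ 1 → z ≠ 2 → HeunEqC l (fun w => P.eval w) z) :
    C 4 * (X * (X * (X * derivative (derivative P))))
      + C (-12) * (X * (X * derivative (derivative P)))
      + C 8 * (X * derivative (derivative P))
      + C (16 + 4 * l) * (X * (X * derivative P))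
      + C (-44 - 8 * l) * (X * derivative P)
      + C 28 * derivative P
      + C ((l + 4) * (l + 2)) * (X * P) + C (-(l ^ 2 + 12 * l + 12)) * P = 0 := by
  refine Polynomial.eq_of_infinite_eval_eq _ _
    (Set.Infinite.mono ?_ (Set.toFinite ({0, 1, 2} : Set ℂ)).infinite_compl)
  intro z hz
  simp only [Set.mem_compl_iff, Set.mem_insert_iff, Set.mem_singleton_iff, not_or] at hz
  obtain ⟨h0, h1, h2⟩ := hz
  have h := heq z h0 h1 h2
  have hd (Q : Polynomial ℂ) : deriv (fun w => Q.eval w) = fun w => (derivative Q).eval w :=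
    funext fun w => Q.deriv
  have h1' : z - 1 ≠ 0 := sub_ne_zero.mpr h1
  have h2' : z - 2 ≠ 0 := sub_ne_zero.mpr h2
  simp only [HeunEqC, hd] at h
  field_simp at h
  simp only [Set.mem_ofPred_eq, eval_add, eval_mul, eval_C, eval_X, eval_zero]
  linear_combination h / 2

/-- The indicial polynomial of the Heun equation at infinity has no natural number as a root. -/
theorem heun_indicial_ne_zero {l : ℂ} (hl : 0 ≤ l.re) (n : ℕ) :
    (2 * n + l + 2) * (2 * n + l + 4) ≠ 0 := by
  have hn : (0 : ℝ) ≤ n := n.cast_nonneg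
  refine mul_ne_zero (fun h => ?_) (fun h => ?_) <;>
  · have := congrArg Complex.re h
    simp at this
    linarith

/-- The Heun equation has no nontrivial polynomial solutions for `Re λ ≥ 0`. -/
theorem no_polynomial_solutions (l : ℂ) (hl : 0 ≤ l.re)
    (P : Polynomial ℂ) (g : ℂ → ℂ) (hg : ∀ z, g z = P.eval z)
    (heq : ∀ z : ℂ, z ≠ 0 → z ≠ 1 → z ≠ 2 → HeunEqC l g z) :
    P = 0 := by
  obtain rfl : g = fun z => P.eval z := funext hg
  have h := congrArg (fun Q => Polynomial.coeff Q (P.natDegree + 1))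
    (heun_polynomial_identity l P heq)
  have hne := heun_indicial_ne_zero hl P.natDegree
  rw [← Polynomial.leadingCoeff_eq_zero, Polynomial.leadingCoeff]
  have c1 : P.coeff (P.natDegree + 1) = 0 := P.coeff_eq_zero_of_natDegree_lt (by omega)
  have c2 : P.coeff (P.natDegree + 1 + 1) = 0 := P.coeff_eq_zero_of_natDegree_lt (by omega)
  refine (mul_eq_zero.mp ?_).resolve_left hne
  generalize P.natDegree = n at *
  rcases n with _ | _ | n <;>
  · simp only [Polynomial.coeff_add, Polynomial.coeff_C_mul, Polynomial.coeff_X_mul,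
      Polynomial.coeff_X_mul_zero, Polynomial.coeff_derivative, Polynomial.coeff_zero,
      c1, c2] at h
    push_cast at h ⊢
    linear_combination h
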